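/- Let H be a complex separable Hilbert space, J a conjugation on H, and A a J-isometric linear operator in H whose domain D(A) and range R(A) are both dense in H. Then there exist a complex separable Hilbert space H̃, an isometric linear embedding ι : H → H̃, a conjugation J̃ on H̃ with J̃(ι(x)) = ι(Jx) for all x ∈ H, and a linear operator B in H̃ with dense domain and dense range such that B extends A (i.e., ι(D(A)) ⊆ D(B) and B(ι(x)) = ι(Ax) for x ∈ D(A)), B is injective, and B is J̃-unitary: J̃B⁻¹J̃ = B*. -/

import Mathlib

open scoped ComplexInnerProductSpace

/-- The data of a `J̃`-unitary extension of a `J`-isometric operator `A` in a possibly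
larger complex separable Hilbert space: a complex separable Hilbert space `carrier`, an
isometric linear embedding `ι : H → carrier`, a conjugation `Jt` on `carrier` extending `J`
(via `ι`), and an injective operator `B` with dense domain and dense range extending `A`
(via `ι`) which is `J̃`-unitary: `J̃ B⁻¹ J̃ = B*` (expressed by the equality of the graph of
`B*` with the graph of `J̃ B⁻¹ J̃`, which encodes `D(B*) = J̃(R(B))` and
`B* u = J̃ B⁻¹ J̃ u`). -/
structure JUnitaryConjExtension
    {H : Type*} [NormedAddCommGroup H] [InnerProductSpace ℂ H] [CompleteSpace H]
    (J : H → H) (A : H →ₗ.[ℂ] H) where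
  carrier : Type
  [ng : NormedAddCommGroup carrier]
  [ip : InnerProductSpace ℂ carrier]
  [cs : CompleteSpace carrier]
  [sep : TopologicalSpace.SeparableSpace carrier]
  ι : H →ₗ[ℂ] carrier
  ι_inner : ∀ x y : H, ⟪ι x, ι y⟫ = ⟪x, y⟫
  Jt : carrier → carrier
  Jt_add : ∀ x y : carrier, Jt (x + y) = Jt x + Jt y
  Jt_smul : ∀ (c : ℂ) (x : carrier), Jt (c • x) = (starRingEnd ℂ c) • Jt x
  Jt_invol : ∀ x : carrier, Jt (Jt x) = x
  Jt_inner : ∀ x y : carrier, ⟪Jt x, Jt y⟫ = ⟪y, x⟫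
  Jt_extends : ∀ x : H, Jt (ι x) = ι (J x)
  B : carrier →ₗ.[ℂ] carrier
  B_dense : Dense (B.domain : Set carrier)
  B_range_dense : Dense (LinearMap.range B.toFun : Set carrier)
  B_inj : ∀ x y : B.domain, B x = B y → (x : carrier) = (y : carrier)
  B_extends : ∀ x : A.domain, ∃ h : ι x ∈ B.domain, B ⟨ι x, h⟩ = ι (A x)
  B_jUnitary : ∀ u v : carrier, (u, v) ∈ B.adjoint.graph ↔
    ∃ h : Jt u ∈ B.inverse.domain, v = Jt (B.inverse ⟨Jt u, h⟩)

section Doubling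

variable {V : Type*} [AddCommGroup V] [Module ℂ V]

/-- The subspace `{(p, I p + g) | p ∈ Tᗮ, g ∈ Tᗮᗮ}` of `V × V`, where `ᗮ` is taken with respect to
the bilinear form `Q`. -/
def orthogonalDoubling (Q : LinearMap.BilinForm ℂ V) (T : Submodule ℂ V) : Submodule ℂ (V × V) :=
  (Q.orthogonal T).comap (LinearMap.fst ℂ V V) ⊓
    (Q.orthogonal (Q.orthogonal T)).comap (LinearMap.snd ℂ V V - Complex.I • LinearMap.fst ℂ V V)

theorem mem_orthogonalDoubling {Q : LinearMap.BilinForm ℂ V} {T : Submodule ℂ V} {x : V × V} :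
    x ∈ orthogonalDoubling Q T ↔ x.1 ∈ Q.orthogonal T ∧
      x.2 - Complex.I • x.1 ∈ Q.orthogonal (Q.orthogonal T) :=
  Iff.rfl

theorem prod_le_orthogonalDoubling {Q : LinearMap.BilinForm ℂ V} (hQ : Q.IsSymm)
    {T : Submodule ℂ V} (hT : T ≤ Q.orthogonal T) : T.prod T ≤ orthogonalDoubling Q T :=
  fun _ hx => ⟨hT hx.1, Q.le_orthogonal_orthogonal hQ.isRefl
    (T.sub_mem hx.2 (T.smul_mem _ hx.1))⟩

/-- The doubling of an isotropic subspace is equal to its own orthogonal complement with respect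
to the orthogonal sum of two copies of the form. -/
theorem mem_orthogonalDoubling_iff_forall {Q : LinearMap.BilinForm ℂ V} (hQ : Q.IsSymm)
    {T : Submodule ℂ V} (hT : T ≤ Q.orthogonal T) {x : V × V} :
    x ∈ orthogonalDoubling Q T ↔
      ∀ y ∈ orthogonalDoubling Q T, Q y.1 x.1 + Q y.2 x.2 = 0 := by
  have hle : Q.orthogonal (Q.orthogonal T) ≤ Q.orthogonal T := Q.orthogonal_le hT
  have hsymm : ∀ a b, Q a b = Q b a := fun a b => hQ.eq a b
  constructor
  · intro hx y hy
    obtain ⟨hx₁, hx₂⟩ := mem_orthogonalDoubling.1 hx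
    obtain ⟨hy₁, hy₂⟩ := mem_orthogonalDoubling.1 hy
    obtain ⟨a, b⟩ := x
    obtain ⟨p, q⟩ := y
    obtain ⟨h, rfl⟩ : ∃ h, b = Complex.I • a + h := ⟨b - Complex.I • a, by abel⟩
    obtain ⟨g, rfl⟩ : ∃ g, q = Complex.I • p + g := ⟨q - Complex.I • p, by abel⟩
    rw [add_sub_cancel_left] at hx₂ hy₂
    have h₁ : Q p h = 0 := hx₂ p hy₁
    have h₂ : Q g a = 0 := (hsymm g a).trans (hy₂ a hx₁)
    have h₃ : Q g h = 0 := hx₂ g (hle hy₂)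
    simp only [map_add, map_smul, LinearMap.add_apply, LinearMap.smul_apply, smul_eq_mul, h₁, h₂,
      h₃]
    linear_combination Q p a * Complex.I_mul_I
  · intro h
    have hx₂ : x.2 ∈ Q.orthogonal T := fun t ht => by
      have := h (0, t) ⟨(Q.orthogonal T).zero_mem, by
        simpa using Q.le_orthogonal_orthogonal hQ.isRefl ht⟩
      simpa using this
    have hsum : x.1 + Complex.I • x.2 ∈ Q.orthogonal (Q.orthogonal T) := fun p hp => by
      have := h (p, Complex.I • p) ⟨hp, by simp⟩
      simpa using this
    refine ⟨?_, ?_⟩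
    · simpa using (Q.orthogonal T).sub_mem (hle hsum) ((Q.orthogonal T).smul_mem Complex.I hx₂)
    · have := (Q.orthogonal (Q.orthogonal T)).smul_mem (-Complex.I) hsum
      simpa [smul_smul, sub_eq_add_neg, add_comm] using this

end Doubling

section Conjugation

variable {E : Type*} [NormedAddCommGroup E] [InnerProductSpace ℂ E]

/-- `J` is a conjugation: an antilinear, antiunitary involution. -/
structure IsConjugation (J : E → E) : Prop where
  map_add : ∀ x y, J (x + y) = J x + J y
  map_smul : ∀ (c : ℂ) x, J (c • x) = (starRingEnd ℂ c) • J x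
  invol : ∀ x, J (J x) = x
  inner_map_map : ∀ x y, ⟪J x, J y⟫ = ⟪y, x⟫

namespace IsConjugation

variable {J : E → E}

theorem map_zero (hJ : IsConjugation J) : J 0 = 0 := by
  simpa using hJ.map_smul 0 0

theorem inner_map_left (hJ : IsConjugation J) (x y : E) : ⟪J x, y⟫ = ⟪J y, x⟫ := by
  rw [← hJ.inner_map_map, hJ.invol]

theorem conj (hJ : IsConjugation J) {F : Type*} [NormedAddCommGroup F] [InnerProductSpace ℂ F]
    (Φ : E ≃ₗᵢ[ℂ] F) :
    IsConjugation fun x => Φ (J (Φ.symm x)) where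
  map_add x y := by simp [hJ.map_add]
  map_smul c x := by simp [hJ.map_smul]
  invol x := by simp [hJ.invol]
  inner_map_map x y := by simp [hJ.inner_map_map]

theorem prod (hJ : IsConjugation J) :
    IsConjugation fun x : WithLp 2 (E × E) => WithLp.toLp 2 (J x.fst, J x.snd) where
  map_add x y := by simp [hJ.map_add, ← WithLp.toLp_add]
  map_smul c x := by simp [hJ.map_smul, ← WithLp.toLp_smul]
  invol x := by
    simp only [WithLp.toLp_fst, WithLp.toLp_snd, hJ.invol]
    rfl
  inner_map_map x y := by simp [hJ.inner_map_map]

/-- The symmetric bilinear form `⟪J p₁, q₁⟫ - ⟪J p₂, q₂⟫` on `E × E`. -/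
noncomputable def graphForm (hJ : IsConjugation J) : LinearMap.BilinForm ℂ (E × E) :=
  LinearMap.mk₂ ℂ (fun p q => ⟪J p.1, q.1⟫ - ⟪J p.2, q.2⟫)
    (fun p p' q => by simp only [Prod.fst_add, Prod.snd_add, hJ.map_add, inner_add_left]; ring)
    (fun c p q => by
      simp only [Prod.smul_fst, Prod.smul_snd, hJ.map_smul, inner_smul_left, Complex.conj_conj,
        smul_eq_mul]
      ring)
    (fun p q q' => by simp only [Prod.fst_add, Prod.snd_add, inner_add_right]; ring)
    (fun c p q => by
      simp only [Prod.smul_fst, Prod.smul_snd, inner_smul_right, smul_eq_mul]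
      ring)

theorem graphForm_apply (hJ : IsConjugation J) (p q : E × E) :
    hJ.graphForm p q = ⟪J p.1, q.1⟫ - ⟪J p.2, q.2⟫ :=
  rfl

theorem graphForm_isSymm (hJ : IsConjugation J) : hJ.graphForm.IsSymm :=
  ⟨fun p q => by
    simp only [graphForm_apply, hJ.inner_map_left p.1, hJ.inner_map_left p.2]⟩

theorem eq_zero_of_inner_map_left (hJ : IsConjugation J) {S : Set E} (hS : Dense S) {x : E}
    (h : ∀ s ∈ S, ⟪J s, x⟫ = 0) : x = 0 := by
  have : J x = 0 := hS.eq_zero_of_inner_left ℂ fun s hs => by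
    rw [hJ.inner_map_left, h s hs]
  rw [← hJ.invol x, this, hJ.map_zero]

/-- A subspace of `E × E` with dense projections which is maximal isotropic for the graph form is
the graph of a `J`-unitary operator. -/
theorem exists_jUnitary_of_graph [CompleteSpace E] (hJ : IsConjugation J)
    {G : Submodule ℂ (E × E)}
    (hG : ∀ x, x ∈ G ↔ ∀ y ∈ G, ⟪J y.1, x.1⟫ = ⟪J y.2, x.2⟫)
    (hfst : Dense (Prod.fst '' (G : Set (E × E)))) (hsnd : Dense (Prod.snd '' (G : Set (E × E)))) :
    ∃ B : E →ₗ.[ℂ] E, B.graph = G ∧ Dense (B.domain : Set E) ∧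
      Dense (LinearMap.range B.toFun : Set E) ∧
      (∀ x y : B.domain, B x = B y → (x : E) = y) ∧
      ∀ u v : E, (u, v) ∈ B.adjoint.graph ↔
        ∃ h : J u ∈ B.inverse.domain, v = J (B.inverse ⟨J u, h⟩) := by
  have hzero₁ : ∀ x ∈ G, x.1 = 0 → x.2 = 0 := fun x hx hx₁ =>
    hJ.eq_zero_of_inner_map_left hsnd <| by
      rintro _ ⟨y, hy, rfl⟩
      rw [← (hG x).1 hx y hy, hx₁, inner_zero_right]
  have hzero₂ : ∀ x ∈ G, x.2 = 0 → x.1 = 0 := fun x hx hx₂ =>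
    hJ.eq_zero_of_inner_map_left hfst <| by
      rintro _ ⟨y, hy, rfl⟩
      rw [(hG x).1 hx y hy, hx₂, inner_zero_right]
  have hgraph : G.toLinearPMap.graph = G := G.toLinearPMap_graph_eq hzero₁
  set B := G.toLinearPMap
  have hmem : ∀ x : B.domain, ((x : E), B x) ∈ G := fun x => hgraph ▸ B.mem_graph x
  have hker : LinearMap.ker B.toFun = ⊥ := LinearMap.ker_eq_bot'.2 fun x hx =>
    Subtype.ext (hzero₂ _ (hmem x) hx)
  have hdom : Dense (B.domain : Set E) := hfst
  refine ⟨B, hgraph, hdom, ?_, ?_, ?_⟩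
  · rw [← B.graph_map_snd_eq_range, hgraph]
    exact hsnd
  · intro x y hxy
    exact congrArg Subtype.val (LinearMap.ker_eq_bot.1 hker hxy)
  · intro u v
    have hadj : (u, v) ∈ B.adjoint.graph ↔ (J v, J u) ∈ G := by
      rw [LinearPMap.adjoint_graph_eq_graph_adjoint hdom, hgraph, Submodule.mem_adjoint_iff, hG]
      simp only [Prod.forall, hJ.inner_map_map, sub_eq_zero]
      refine forall₃_congr fun a b _ => ?_
      rw [← inner_conj_symm b u, ← inner_conj_symm a v, (starRingEnd ℂ).injective.eq_iff]
      exact eq_comm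
    have hinv : ∀ a b, (a, b) ∈ B.inverse.graph ↔ (b, a) ∈ G := fun a b => by
      rw [LinearPMap.inverse_graph hker, hgraph]
      constructor
      · rintro ⟨⟨c, d⟩, h, heq⟩
        cases heq
        exact h
      · exact fun h => ⟨(b, a), h, rfl⟩
    rw [hadj, ← hinv, LinearPMap.mem_graph_iff]
    constructor
    · rintro ⟨⟨y, hy⟩, rfl, hv⟩
      exact ⟨hy, by rw [hv, hJ.invol]⟩
    · rintro ⟨h, rfl⟩
      exact ⟨⟨J u, h⟩, rfl, (hJ.invol _).symm⟩

/-- Every isotropic subspace of `E × E` with dense projections yields a `J ⊕ J`-unitary operator in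
`E ⊕ E` whose graph contains two copies of it. -/
theorem exists_jUnitary_prod [CompleteSpace E] (hJ : IsConjugation J)
    {T : Submodule ℂ (E × E)}
    (hT : ∀ x ∈ T, ∀ y ∈ T, ⟪J x.1, y.1⟫ = ⟪J x.2, y.2⟫)
    (hfst : Dense (Prod.fst '' (T : Set (E × E)))) (hsnd : Dense (Prod.snd '' (T : Set (E × E)))) :
    ∃ B : WithLp 2 (E × E) →ₗ.[ℂ] WithLp 2 (E × E),
      (∀ x ∈ T, (WithLp.toLp 2 (x.1, 0), WithLp.toLp 2 (x.2, 0)) ∈ B.graph) ∧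
      Dense (B.domain : Set (WithLp 2 (E × E))) ∧
      Dense (LinearMap.range B.toFun : Set (WithLp 2 (E × E))) ∧
      (∀ x y : B.domain, B x = B y → (x : WithLp 2 (E × E)) = y) ∧
      ∀ u v : WithLp 2 (E × E), (u, v) ∈ B.adjoint.graph ↔
        ∃ h : WithLp.toLp 2 (J u.fst, J u.snd) ∈ B.inverse.domain,
          v = WithLp.toLp 2 (J (B.inverse ⟨_, h⟩).fst, J (B.inverse ⟨_, h⟩).snd) := by
  have hT' : T ≤ hJ.graphForm.orthogonal T := fun y hy x hx => sub_eq_zero.2 (hT x hx y hy)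
  let e : (WithLp 2 (E × E) × WithLp 2 (E × E)) ≃ₗ[ℂ] (E × E) × (E × E) :=
    ((WithLp.linearEquiv 2 ℂ (E × E)).prodCongr (WithLp.linearEquiv 2 ℂ (E × E))).trans
      (LinearEquiv.prodProdProdComm ℂ E E E E)
  let G := (orthogonalDoubling hJ.graphForm T).comap e.toLinearMap
  have hprod : ∀ x ∈ T, ∀ y ∈ T,
      (WithLp.toLp 2 (x.1, y.1), WithLp.toLp 2 (x.2, y.2)) ∈ G := fun x hx y hy =>
    prod_le_orthogonalDoubling hJ.graphForm_isSymm hT' (x := (x, y)) ⟨hx, hy⟩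
  have hdense : ∀ S : Set E, Dense S → Dense (WithLp.toLp 2 '' S ×ˢ S) := fun S hS =>
    (WithLp.homeomorphProd 2 E E).symm.surjective.denseRange.dense_image
      (WithLp.homeomorphProd 2 E E).symm.continuous (hS.prod hS)
  obtain ⟨B, hB, h⟩ := hJ.prod.exists_jUnitary_of_graph (G := G)
    (fun x => by
      change e x ∈ orthogonalDoubling hJ.graphForm T ↔ _
      rw [mem_orthogonalDoubling_iff_forall hJ.graphForm_isSymm hT',
        e.surjective.forall]
      refine forall₂_congr fun y _ => ?_
      rw [← sub_eq_zero (a := inner ℂ _ _)]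
      simp only [graphForm_apply, WithLp.prod_inner_apply]
      refine Eq.congr_left ?_
      change ⟪J y.1.fst, x.1.fst⟫ - ⟪J y.2.fst, x.2.fst⟫ +
        (⟪J y.1.snd, x.1.snd⟫ - ⟪J y.2.snd, x.2.snd⟫) =
        ⟪J y.1.fst, x.1.fst⟫ + ⟪J y.1.snd, x.1.snd⟫ -
        (⟪J y.2.fst, x.2.fst⟫ + ⟪J y.2.snd, x.2.snd⟫)
      ring)
    ((hdense _ hfst).mono <| by
      rintro _ ⟨⟨_, _⟩, ⟨⟨x, hx, rfl⟩, ⟨y, hy, rfl⟩⟩, rfl⟩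
      exact ⟨_, hprod x hx y hy, rfl⟩)
    ((hdense _ hsnd).mono <| by
      rintro _ ⟨⟨_, _⟩, ⟨⟨x, hx, rfl⟩, ⟨y, hy, rfl⟩⟩, rfl⟩
      exact ⟨_, hprod x hx y hy, rfl⟩)
  exact ⟨B, fun x hx => hB ▸ hprod x hx 0 T.zero_mem, h⟩

end IsConjugation

end Conjugation

section Separable

variable {H : Type*} [NormedAddCommGroup H] [InnerProductSpace ℂ H]
  [TopologicalSpace.SeparableSpace H]

theorem Orthonormal.countable {ι : Type*} {v : ι → H} (hv : Orthonormal ℂ v) : Countable ι := by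
  have hdist : ∀ i j, i ≠ j → 1 ≤ dist (v i) (v j) := fun i j hij => by
    have h := norm_sub_sq (𝕜 := ℂ) (v i) (v j)
    rw [hv.2 hij, hv.1 i, hv.1 j, ← dist_eq_norm] at h
    simp only [map_zero] at h
    nlinarith [dist_nonneg (x := v i) (y := v j)]
  refine Set.countable_univ_iff.1 <| Set.PairwiseDisjoint.countable_of_isOpen
    (s := fun i => Metric.ball (v i) (1 / 2)) (fun i _ j _ hij => ?_)
    (fun _ _ => Metric.isOpen_ball) fun i _ => ⟨v i, Metric.mem_ball_self (by norm_num)⟩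
  exact Metric.ball_disjoint_ball (by linarith [hdist i j hij])

/-- A separable Hilbert space in any universe is isometric to an `ℓ²` space in `Type`. -/
theorem exists_linearIsometryEquiv_lp [CompleteSpace H] :
    ∃ s : Type, Nonempty (H ≃ₗᵢ[ℂ] lp (fun _ : s => ℂ) 2) := by
  obtain ⟨w, b, -⟩ := exists_hilbertBasis ℂ H
  have := b.orthonormal.countable
  let f := (equivShrink.{0} w).symm
  refine ⟨Shrink.{0} w, ⟨(HilbertBasis.mk (b.orthonormal.comp f f.injective) ?_).repr⟩⟩
  rw [f.surjective.range_comp]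
  exact b.dense_span.ge

end Separable

/-- **Theorem 2.1, isometric case.** Every `J`-isometric operator `A` with
dense domain and dense range in a complex separable Hilbert space `H` admits a `J̃`-unitary
extension `B` in a complex separable Hilbert space `H̃ ⊇ H`, where `J̃` is a conjugation on
`H̃` extending `J`. -/
theorem exists_jUnitary_extension
    {H : Type*} [NormedAddCommGroup H] [InnerProductSpace ℂ H] [CompleteSpace H]
    [TopologicalSpace.SeparableSpace H]
    (J : H → H)
    (hJ_add : ∀ x y : H, J (x + y) = J x + J y)
    (hJ_smul : ∀ (c : ℂ) (x : H), J (c • x) = (starRingEnd ℂ c) • J x)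
    (hJ_invol : ∀ x : H, J (J x) = x)
    (hJ_inner : ∀ x y : H, ⟪J x, J y⟫ = ⟪y, x⟫)
    (A : H →ₗ.[ℂ] H) (hA_dense : Dense (A.domain : Set H))
    (hA_range_dense : Dense (LinearMap.range A.toFun : Set H))
    (hA_isom : ∀ x y : A.domain, ⟪A x, J (A y)⟫ = ⟪(x : H), J (y : H)⟫) :
    Nonempty (JUnitaryConjExtension J A) := by
  obtain ⟨s, ⟨Φ⟩⟩ := exists_linearIsometryEquiv_lp (H := H)
  have hJ : IsConjugation J := ⟨hJ_add, hJ_smul, hJ_invol, hJ_inner⟩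
  have hK := hJ.conj Φ
  have : TopologicalSpace.SeparableSpace (lp (fun _ : s => ℂ) 2) :=
    Φ.surjective.denseRange.separableSpace Φ.continuous
  have : TopologicalSpace.SeparableSpace
      (WithLp 2 (lp (fun _ : s => ℂ) 2 × lp (fun _ : s => ℂ) 2)) :=
    (WithLp.homeomorphProd 2 _ _).symm.surjective.denseRange.separableSpace
      (WithLp.homeomorphProd 2 _ _).symm.continuous
  let e : H →ₗ[ℂ] lp (fun _ : s => ℂ) 2 := Φ.toLinearEquiv
  have hdense : ∀ S : Set H, Dense S → Dense (Φ '' S) := fun S hS =>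
    Φ.surjective.denseRange.dense_image Φ.continuous hS
  obtain ⟨B, hB, hdom, hrange, hinj, hunit⟩ :=
    hK.exists_jUnitary_prod (T := A.graph.map (e.prodMap e))
    (by
      rintro _ ⟨p, hp, rfl⟩ _ ⟨q, hq, rfl⟩
      obtain ⟨x, rfl⟩ := A.mem_graph_iff'.1 hp
      obtain ⟨y, rfl⟩ := A.mem_graph_iff'.1 hq
      have h := hA_isom y x
      change ⟪Φ (J (Φ.symm (Φ x))), Φ y⟫ = ⟪Φ (J (Φ.symm (Φ (A x)))), Φ (A y)⟫
      simp only [LinearIsometryEquiv.symm_apply_apply, LinearIsometryEquiv.inner_map_map]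
      rw [← inner_conj_symm, ← h, inner_conj_symm])
    ((hdense _ hA_dense).mono <| by
      rintro _ ⟨x, hx, rfl⟩
      exact ⟨_, ⟨_, A.mem_graph ⟨x, hx⟩, rfl⟩, rfl⟩)
    ((hdense _ hA_range_dense).mono <| by
      rintro _ ⟨_, ⟨x, rfl⟩, rfl⟩
      exact ⟨_, ⟨_, A.mem_graph x, rfl⟩, rfl⟩)
  exact ⟨{
    carrier := WithLp 2 (lp (fun _ : s => ℂ) 2 × lp (fun _ : s => ℂ) 2)
    ι := (WithLp.linearEquiv 2 ℂ _).symm.toLinearMap ∘ₗ LinearMap.inl ℂ _ _ ∘ₗ e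
    ι_inner := fun x y => by simp [e]
    Jt := _
    Jt_add := hK.prod.map_add
    Jt_smul := hK.prod.map_smul
    Jt_invol := hK.prod.invol
    Jt_inner := hK.prod.inner_map_map
    Jt_extends := fun x => by simp [e, hJ.map_zero]
    B := B
    B_dense := hdom
    B_range_dense := hrange
    B_inj := hinj
    B_extends := fun x => by
      obtain ⟨y, hy, hy'⟩ := B.mem_graph_iff.1 (hB _ ⟨_, A.mem_graph x, rfl⟩)
      obtain ⟨y, hmem⟩ := y
      obtain rfl : y = _ := hy
      exact ⟨hmem, hy'⟩
    B_jUnitary := hunit }⟩
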